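/- Suppose nodes 1, 2 ∈ V satisfy 𝒩'_1 ⊆ 𝒩'_2, and fix the curing initialization B and the parameters Δ. Given an infection initialization R, define R* by R*_1 = 0, R*_2 = R_1 + R_2, and R*_k = R_k for all k ∉ {1,2}. Then for every n ≥ 1, Ĩ_n(B, R*) ≥ Ĩ_n(B, R). Hence, when maximizing the average infection rate Ĩ_n over infection initializations, a node whose closed neighborhood is nested in another node's closed neighborhood may be assumed to receive no red balls. -/

import Mathlib

open Finset

noncomputable section

namespace Polya

variable {N : ℕ}

/-- Closed neighborhood of node `i`. -/
def nbhd (G : SimpleGraph (Fin N)) [DecidableRel G.Adj] (i : Fin N) : Finset (Fin N) :=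
  insert i (G.neighborFinset i)

/-- Super-urn count of a vector `x` at node `i`. -/
def bar (G : SimpleGraph (Fin N)) [DecidableRel G.Adj] (x : Fin N → ℝ) (i : Fin N) : ℝ :=
  ∑ j ∈ nbhd G i, x j

/-- Super-urn proportion of node `i` after `n` draws with history `a`
(`a j t` is the draw of node `j` at time `t+1`). -/
def S (G : SimpleGraph (Fin N)) [DecidableRel G.Adj] (B R : Fin N → ℝ)
    (Δr Δb : Fin N → ℕ → ℝ) (n : ℕ) (a : Fin N → ℕ → Bool) (i : Fin N) : ℝ :=
  (bar G R i + ∑ j ∈ nbhd G i, ∑ t ∈ Finset.range n, if a j t then Δr j t else 0) /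
    (bar G R i + bar G B i +
      ∑ j ∈ nbhd G i, ∑ t ∈ Finset.range n, if a j t then Δr j t else Δb j t)

/-- Extension of a finite draw history to an `ℕ`-indexed one. -/
def ext (n : ℕ) (a : Fin N → Fin n → Bool) : Fin N → ℕ → Bool :=
  fun j t => if h : t < n then a j ⟨t, h⟩ else false

/-- Joint probability of the draw history `a` over the first `n` draws. -/
def Pjoint (G : SimpleGraph (Fin N)) [DecidableRel G.Adj] (B R : Fin N → ℝ)
    (Δr Δb : Fin N → ℕ → ℝ) (n : ℕ) (a : Fin N → ℕ → Bool) : ℝ :=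
  ∏ t ∈ Finset.range n, ∏ i : Fin N,
    if a i t then S G B R Δr Δb t a i else 1 - S G B R Δr Δb t a i

/-- Average infection rate at time `n` (for `n ≥ 1`). -/
def Itilde (G : SimpleGraph (Fin N)) [DecidableRel G.Adj] (B R : Fin N → ℝ)
    (Δr Δb : Fin N → ℕ → ℝ) (n : ℕ) : ℝ :=
  (1 / (N : ℝ)) * ∑ i : Fin N, ∑ a : Fin N → Fin (n - 1) → Bool,
    S G B R Δr Δb (n - 1) (ext (n - 1) a) i * Pjoint G B R Δr Δb (n - 1) (ext (n - 1) a)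

theorem bern_aux {u v a b c d : ℝ} (a0 : 0 ≤ u) (a1 : v ≤ 1) (a2 : u ≤ v)
    (kt : a ≤ c) (kf : b ≤ d) (kk : b ≤ a) : u * a + (1 - u) * b ≤ v * c + (1 - v) * d := by
  nlinarith [mul_nonneg (sub_nonneg.2 a2) (sub_nonneg.2 kk),
    mul_nonneg (a0.trans a2) (sub_nonneg.2 kt), mul_nonneg (sub_nonneg.2 a1) (sub_nonneg.2 kf)]

theorem bern_mono : ∀ (M : ℕ) (p p' : Fin M → ℝ) (_ : ∀ i, 0 ≤ p i) (_ : ∀ i, p' i ≤ 1)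
    (_ : ∀ i, p i ≤ p' i) (f g : (Fin M → Bool) → ℝ) (_ : ∀ x, f x ≤ g x) (_ : Monotone f),
    ∑ x, (∏ i, if x i then p i else 1 - p i) * f x
      ≤ ∑ x, (∏ i, if x i then p' i else 1 - p' i) * g x := by
  intro M
  induction M with
  | zero =>
    intro p p' _ _ _ f g hfg _
    simpa using hfg _
  | succ M ih =>
    intro p p' h0 h1 hp f g hfg hf
    rw [← (Fin.consEquiv (fun _ : Fin (M+1) => Bool)).sum_comp,
      ← (Fin.consEquiv (fun _ : Fin (M+1) => Bool)).sum_comp]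
    simp only [Fin.consEquiv_apply, Fintype.sum_prod_type, Fin.prod_univ_succ, Fin.cons_zero,
      Fin.cons_succ, Fintype.sum_bool, if_true, Bool.false_eq_true, if_false, mul_assoc,
      ← Finset.mul_sum]
    have hm : ∀ b : Bool, Monotone fun x : Fin M → Bool => f (Fin.cons b x) := by
      intro b x y hxy
      apply hf
      exact Fin.cons_le_cons.2 ⟨le_rfl, hxy⟩
    have key : ∀ b : Bool, _ := fun b => ih (fun i => p i.succ) (fun i => p' i.succ)
      (fun i => h0 _) (fun i => h1 _) (fun i => hp _) (fun x => f (Fin.cons b x))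
      (fun x => g (Fin.cons b x)) (fun x => hfg _) (hm b)
    have kt := key true
    have kf := key false
    have kk := ih (fun i => p i.succ) (fun i => p i.succ)
      (fun i => h0 _) (fun i => (hp _).trans (h1 _)) (fun i => le_rfl)
      (fun x => f (Fin.cons false x))
      (fun x => f (Fin.cons true x))
      (fun x => hf (Fin.cons_le_cons.2 ⟨Bool.false_le _, le_rfl⟩)) (hm false)
    have a0 := h0 0
    have a1 := h1 0
    have a2 := hp 0
    exact bern_aux a0 a1 a2 kt kf kk

def Rx (R : Fin N → ℝ) (Δr : Fin N → ℕ → ℝ) (x : Fin N → Bool) : Fin N → ℝ :=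
  fun j => R j + if x j then Δr j 0 else 0

def Bx (B : Fin N → ℝ) (Δb : Fin N → ℕ → ℝ) (x : Fin N → Bool) : Fin N → ℝ :=
  fun j => B j + if x j then 0 else Δb j 0

def cns (x : Fin N → Bool) (a : Fin N → ℕ → Bool) : Fin N → ℕ → Bool :=
  fun j t => match t with
    | 0 => x j
    | t + 1 => a j t

theorem S_cns (G : SimpleGraph (Fin N)) [DecidableRel G.Adj] (B R : Fin N → ℝ)
    (Δr Δb : Fin N → ℕ → ℝ) (n : ℕ) (x : Fin N → Bool) (a : Fin N → ℕ → Bool) (i : Fin N) :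
    S G B R Δr Δb (n+1) (cns x a) i
      = S G (Bx B Δb x) (Rx R Δr x) (fun j t => Δr j (t+1)) (fun j t => Δb j (t+1)) n a i := by
  unfold S bar Rx Bx
  simp only [Finset.sum_range_succ', cns, ← Finset.sum_add_distrib]
  congr 1
  · apply Finset.sum_congr rfl; intro j _
    by_cases hx : x j = true <;> simp [hx] <;> ring
  · apply Finset.sum_congr rfl; intro j _
    by_cases hx : x j = true <;> simp [hx] <;> ring

theorem S_zero (G : SimpleGraph (Fin N)) [DecidableRel G.Adj] (B R : Fin N → ℝ)
    (Δr Δb : Fin N → ℕ → ℝ) (a : Fin N → ℕ → Bool) (i : Fin N) :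
    S G B R Δr Δb 0 a i = bar G R i / (bar G R i + bar G B i) := by
  simp [S]

theorem P_cns (G : SimpleGraph (Fin N)) [DecidableRel G.Adj] (B R : Fin N → ℝ)
    (Δr Δb : Fin N → ℕ → ℝ) (n : ℕ) (x : Fin N → Bool) (a : Fin N → ℕ → Bool) :
    Pjoint G B R Δr Δb (n+1) (cns x a)
      = (∏ i, if x i then bar G R i / (bar G R i + bar G B i)
            else 1 - bar G R i / (bar G R i + bar G B i)) *
        Pjoint G (Bx B Δb x) (Rx R Δr x) (fun j t => Δr j (t+1)) (fun j t => Δb j (t+1)) n a := by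
  unfold Pjoint
  rw [Finset.prod_range_succ', mul_comm]
  simp only [S_cns, S_zero]
  rfl

def W (G : SimpleGraph (Fin N)) [DecidableRel G.Adj] (B R : Fin N → ℝ)
    (Δr Δb : Fin N → ℕ → ℝ) (n : ℕ) (i : Fin N) : ℝ :=
  ∑ a : Fin N → Fin n → Bool, S G B R Δr Δb n (ext n a) i * Pjoint G B R Δr Δb n (ext n a)

def eqv (N n : ℕ) : (Fin N → Bool) × (Fin N → Fin n → Bool) ≃ (Fin N → Fin (n+1) → Bool) where
  toFun z := fun j => Fin.cons (z.1 j) (z.2 j)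
  invFun a := (fun j => a j 0, fun j t => a j t.succ)
  left_inv z := by simp
  right_inv a := by
    funext j t
    refine Fin.cases ?_ (fun t => ?_) t <;> simp

theorem ext_eqv (n : ℕ) (x : Fin N → Bool) (a : Fin N → Fin n → Bool) :
    ext (n+1) (eqv N n (x, a)) = cns x (ext n a) := by
  funext j t
  cases t with
  | zero => simp [ext, eqv, cns]
  | succ t =>
    simp only [ext, eqv, cns, Equiv.coe_fn_mk, Nat.add_lt_add_iff_right]
    split_ifs with h
    · exact Fin.cons_succ (α := fun _ => Bool) (x j) (a j) ⟨t, h⟩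
    · rfl

theorem W_succ (G : SimpleGraph (Fin N)) [DecidableRel G.Adj] (B R : Fin N → ℝ)
    (Δr Δb : Fin N → ℕ → ℝ) (n : ℕ) (i : Fin N) :
    W G B R Δr Δb (n+1) i = ∑ x : Fin N → Bool,
      (∏ i, if x i then bar G R i / (bar G R i + bar G B i)
            else 1 - bar G R i / (bar G R i + bar G B i)) *
      W G (Bx B Δb x) (Rx R Δr x) (fun j t => Δr j (t+1)) (fun j t => Δb j (t+1)) n i := by
  unfold W
  rw [← (eqv N n).sum_comp, Fintype.sum_prod_type]
  apply Finset.sum_congr rfl; intro x _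
  rw [Finset.mul_sum]
  apply Finset.sum_congr rfl; intro a _
  rw [ext_eqv, S_cns, P_cns]
  ring

theorem ratio_mono {r b r' b' : ℝ} (hr : 0 ≤ r) (hb' : 0 ≤ b') (h : r ≤ r') (h' : b' ≤ b)
    (h1 : 0 < r + b) (h2 : 0 < r' + b') : r / (r + b) ≤ r' / (r' + b') := by
  rw [div_le_div_iff₀ h1 h2]
  nlinarith [mul_nonneg hr (sub_nonneg.2 h'), mul_nonneg hb' (sub_nonneg.2 h),
    mul_nonneg (sub_nonneg.2 h) (sub_nonneg.2 h')]

theorem bar_mono (G : SimpleGraph (Fin N)) [DecidableRel G.Adj] {x y : Fin N → ℝ}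
    (h : ∀ j, x j ≤ y j) (i : Fin N) : bar G x i ≤ bar G y i :=
  Finset.sum_le_sum fun j _ => h j

theorem bar_nonneg (G : SimpleGraph (Fin N)) [DecidableRel G.Adj] {x : Fin N → ℝ}
    (h : ∀ j, 0 ≤ x j) (i : Fin N) : 0 ≤ bar G x i :=
  Finset.sum_nonneg fun j _ => h j

theorem W_mono (G : SimpleGraph (Fin N)) [DecidableRel G.Adj] (i : Fin N) : ∀ (n : ℕ)
    (Δr Δb : Fin N → ℕ → ℝ) (_ : ∀ j t, 0 ≤ Δr j t) (_ : ∀ j t, 0 ≤ Δb j t)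
    (B R B' R' : Fin N → ℝ)
    (_ : ∀ j, 0 ≤ R j) (_ : ∀ j, 0 ≤ B j) (_ : ∀ j, 0 ≤ R' j) (_ : ∀ j, 0 ≤ B' j)
    (_ : ∀ j, bar G R j ≤ bar G R' j) (_ : ∀ j, bar G B' j ≤ bar G B j)
    (_ : ∀ j, 0 < bar G R j + bar G B j) (_ : ∀ j, 0 < bar G R' j + bar G B' j),
    W G B R Δr Δb n i ≤ W G B' R' Δr Δb n i := by
  intro n
  induction n with
  | zero =>
    intro Δr Δb hr hb B R B' R' hR hB hR' hB' h1 h2 p1 p2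
    simp only [W, S_zero, Pjoint, Finset.range_zero, Finset.prod_empty, mul_one]
    exact Finset.sum_le_sum fun _ _ =>
      ratio_mono (bar_nonneg G hR i) (bar_nonneg G hB' i) (h1 i) (h2 i) (p1 i) (p2 i)
  | succ n ih =>
    intro Δr Δb hr hb B R B' R' hR hB hR' hB' h1 h2 p1 p2
    have nR : ∀ {R : Fin N → ℝ} (_ : ∀ j, 0 ≤ R j) x j, 0 ≤ Rx R Δr x j := by
      intro R hR x j
      unfold Rx; split_ifs <;> linarith [hR j, hr j 0]
    have nB : ∀ {B : Fin N → ℝ} (_ : ∀ j, 0 ≤ B j) x j, 0 ≤ Bx B Δb x j := by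
      intro B hB x j
      unfold Bx; split_ifs <;> linarith [hB j, hb j 0]
    have gR : ∀ (R : Fin N → ℝ) x j, bar G R j ≤ bar G (Rx R Δr x) j := by
      intro R x j
      apply bar_mono
      intro j
      unfold Rx; split_ifs <;> linarith [hr j 0]
    have gB : ∀ (B : Fin N → ℝ) x j, bar G B j ≤ bar G (Bx B Δb x) j := by
      intro B x j
      apply bar_mono
      intro j
      unfold Bx; split_ifs <;> linarith [hb j 0]
    have aR : ∀ x j, bar G (Rx R Δr x) j ≤ bar G (Rx R' Δr x) j := by
      intro x j
      have := h1 j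
      simp only [bar, Rx, Finset.sum_add_distrib] at this ⊢
      linarith
    have aB : ∀ x j, bar G (Bx B' Δb x) j ≤ bar G (Bx B Δb x) j := by
      intro x j
      have := h2 j
      simp only [bar, Bx, Finset.sum_add_distrib] at this ⊢
      linarith
    rw [W_succ, W_succ]
    apply bern_mono
    · intro j; exact div_nonneg (bar_nonneg G hR j) (p1 j).le
    · intro j
      rw [div_le_one (p2 j)]
      linarith [bar_nonneg G hB' j]
    · intro j
      exact ratio_mono (bar_nonneg G hR j) (bar_nonneg G hB' j) (h1 j) (h2 j) (p1 j) (p2 j)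
    · intro x
      exact ih _ _ (fun j t => hr _ _) (fun j t => hb _ _) _ _ _ _ (nR hR x) (nB hB x)
        (nR hR' x) (nB hB' x) (aR x) (aB x)
        (fun j => by linarith [p1 j, gR R x j, gB B x j])
        (fun j => by linarith [p2 j, gR R' x j, gB B' x j])
    · intro x y hxy
      refine ih _ _ (fun j t => hr _ _) (fun j t => hb _ _) _ _ _ _ (nR hR x) (nB hB x)
        (nR hR y) (nB hB y) ?_ ?_
        (fun j => by linarith [p1 j, gR R x j, gB B x j])
        (fun j => by linarith [p1 j, gR R y j, gB B y j])
      · intro j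
        apply bar_mono
        intro j
        have h3 : x j = true → y j = true := hxy j
        have h4 := hr j 0
        unfold Rx
        by_cases hx : x j = true
        · simp [hx, h3 hx]
        · by_cases hy : y j = true <;> simp [hx, hy, h4]
      · intro j
        apply bar_mono
        intro j
        have h3 : x j = true → y j = true := hxy j
        have h4 := hb j 0
        unfold Bx
        by_cases hx : x j = true
        · simp [hx, h3 hx]
        · by_cases hy : y j = true <;> simp [hx, hy, h4]

/-- if node `p`'s closed neighborhood is nested in node `q`'s,
moving all red balls of `p` to `q` does not decrease the average infection
rate `Ĩ_n`, for every `n ≥ 1`. -/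
theorem outer_node_no_red_balls_general (hN : 1 ≤ N)
    (G : SimpleGraph (Fin N)) [DecidableRel G.Adj]
    (p q : Fin N) (hpq : p ≠ q) (hsub : nbhd G p ⊆ nbhd G q)
    (B : Fin N → ℝ) (hB : ∀ j, 0 ≤ B j)
    (R : Fin N → ℝ) (hR : ∀ j, 0 ≤ R j)
    (hpos : ∀ i, 0 < bar G R i + bar G B i)
    (Δr Δb : Fin N → ℕ → ℝ) (hΔr : ∀ j t, 0 ≤ Δr j t) (hΔb : ∀ j t, 0 ≤ Δb j t) :
    ∀ n, 1 ≤ n →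
      Itilde G B R Δr Δb n
        ≤ Itilde G B (fun k => if k = p then 0 else if k = q then R p + R q else R k) Δr Δb n := by
  intro n _
  set R' : Fin N → ℝ := fun k => if k = p then 0 else if k = q then R p + R q else R k with hR'
  have hR'0 : ∀ j, 0 ≤ R' j := by
    intro j
    simp only [hR']
    split_ifs <;> linarith [hR j, hR p, hR q]
  have hdec : ∀ k, R' k = R k + ((if k = q then R p else 0) - (if k = p then R p else 0)) := by
    intro k
    simp only [hR']
    by_cases h1 : k = p
    · subst h1; simp [hpq]
    · by_cases h2 : k = q
      · subst h2; simp [h1]; ring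
      · simp [h1, h2]
  have hbar : ∀ i, bar G R i ≤ bar G R' i := by
    intro i
    have hs : ∀ j, j ∈ nbhd G i ↔ i ∈ nbhd G j := by
      intro j
      simp [nbhd, G.adj_comm i j, eq_comm]
    simp only [bar, hdec, Finset.sum_add_distrib, Finset.sum_sub_distrib, Finset.sum_ite_eq']
    by_cases hp : p ∈ nbhd G i
    · have hq : q ∈ nbhd G i := (hs q).2 (hsub ((hs p).1 hp))
      simp [hp, hq]
    · have := hR p
      simp only [hp, if_false]
      split_ifs <;> linarith
  have hw : ∀ i, W G B R Δr Δb (n-1) i ≤ W G B R' Δr Δb (n-1) i := fun i =>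
    W_mono G i (n-1) Δr Δb hΔr hΔb B R B R' hR hB hR'0 hB hbar (fun _ => le_rfl) hpos
      (fun j => by linarith [hpos j, hbar j])
  unfold Itilde
  exact mul_le_mul_of_nonneg_left (Finset.sum_le_sum fun i _ => hw i) (by positivity)

end Polya
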